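/- Let r^(0), …, r^(l−1) ∈ ℝ^N be nonzero, set β^(j) = ‖r^(j)‖₂²/‖r^(j−1)‖₂², let L̃^(l) be the l×l lower bidiagonal matrix with ones on the diagonal and −√(β^(1)), …, −√(β^(l−1)) on the subdiagonal, let ρ = max_{0 ≤ j ≤ i ≤ l−1} ‖r^(i)‖₂²/‖r^(j)‖₂², and set T^(l) = (1/α) L̃^(l) (L̃^(l))ᵀ for α > 0. Then ‖(T^(l))^{−1}‖₂ = α ‖(L̃^(l))^{−1}‖₂² ≤ α ‖(L̃^(l))^{−1}‖_F² ≤ α l (1 + lρ/2), where ‖·‖₂ is the spectral norm and ‖·‖_F the Frobenius norm. -/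

import Mathlib

open Matrix

/-- The Euclidean (ℓ²) norm of a vector in `ℝ^N`. -/
noncomputable def euclNorm {N : ℕ} (x : Fin N → ℝ) : ℝ := Real.sqrt (∑ i, x i ^ 2)

/-- The spectral norm (operator 2-norm) of a real matrix. -/
noncomputable def specNorm {m n : ℕ} (A : Matrix (Fin m) (Fin n) ℝ) : ℝ :=
  ‖(Matrix.toEuclideanLin A).toContinuousLinearMap‖

section

open scoped Matrix.Norms.L2Operator

lemma specNorm_smul {m n : ℕ} (c : ℝ) (A : Matrix (Fin m) (Fin n) ℝ) :
    specNorm (c • A) = |c| * specNorm A :=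
  norm_smul c A

lemma specNorm_transpose_mul_self {m n : ℕ} (A : Matrix (Fin m) (Fin n) ℝ) :
    specNorm (Aᵀ * A) = specNorm A ^ 2 := by
  rw [sq, ← Matrix.conjTranspose_eq_transpose_of_trivial]
  exact Matrix.l2_opNorm_conjTranspose_mul_self A

end

/-- The spectral norm is bounded by the Frobenius norm. -/
lemma specNorm_sq_le_sum_sq {m n : ℕ} (A : Matrix (Fin m) (Fin n) ℝ) :
    specNorm A ^ 2 ≤ ∑ i, ∑ j, A i j ^ 2 := by
  have hF : 0 ≤ ∑ i, ∑ j, A i j ^ 2 := by positivity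
  refine (Real.le_sqrt (norm_nonneg _) hF).1 ?_
  refine ContinuousLinearMap.opNorm_le_bound _ (Real.sqrt_nonneg _) fun x => ?_
  refine (sq_le_sq₀ (norm_nonneg _) (by positivity)).1 ?_
  rw [mul_pow, Real.sq_sqrt hF, EuclideanSpace.real_norm_sq_eq, EuclideanSpace.real_norm_sq_eq,
    Finset.sum_mul]
  exact Finset.sum_le_sum fun i _ => Finset.sum_mul_sq_le_sq_mul_sq Finset.univ (A i) x

lemma euclNorm_nonneg {N : ℕ} (x : Fin N → ℝ) : 0 ≤ euclNorm x :=
  Real.sqrt_nonneg _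

lemma euclNorm_pos {N : ℕ} {x : Fin N → ℝ} (hx : x ≠ 0) : 0 < euclNorm x := by
  obtain ⟨i, hi⟩ := Function.ne_iff.1 hx
  exact Real.sqrt_pos.2 <| Finset.sum_pos' (fun _ _ => sq_nonneg _)
    ⟨i, Finset.mem_univ i, sq_pos_of_ne_zero hi⟩

/-- The lower triangular matrix of ratios `a i / a j` is a right inverse of the unit lower
bidiagonal matrix with subdiagonal entries `-(a i / a (i - 1))`. -/
lemma lowerBidiagonal_mul_ratio {l : ℕ} {a : ℕ → ℝ} (ha : ∀ j < l, a j ≠ 0) :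
    (Matrix.of fun i j : Fin l =>
      if (i : ℕ) = (j : ℕ) then 1
      else if (i : ℕ) = (j : ℕ) + 1 then -(a i / a (i - 1)) else 0) *
    (Matrix.of fun i j : Fin l => if (j : ℕ) ≤ (i : ℕ) then a i / a j else 0) = 1 := by
  ext i k
  rw [Matrix.mul_apply, Matrix.one_apply]
  simp only [Matrix.of_apply]
  have hsplit : ∀ j : Fin l,
      (if (i : ℕ) = (j : ℕ) then (1 : ℝ)
        else if (i : ℕ) = (j : ℕ) + 1 then -(a i / a (i - 1)) else 0) *
        (if (k : ℕ) ≤ (j : ℕ) then a j / a k else 0) =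
      (if i = j then (if (k : ℕ) ≤ (j : ℕ) then a j / a k else 0) else 0) +
      (if (i : ℕ) = (j : ℕ) + 1 then (if (k : ℕ) ≤ (j : ℕ) then -(a i / a k) else 0) else 0) := by
    intro j
    have hj := ha j j.2
    by_cases h : i = j
    · simp [h]
    · have h' : (i : ℕ) ≠ j := fun e => h (Fin.ext e)
      by_cases h1 : (i : ℕ) = j + 1
      · rw [if_neg h', if_pos h1, if_neg h, if_pos h1, zero_add, h1, Nat.add_sub_cancel]
        split_ifs
        · field_simp
        · simp
      · simp [h, h', h1]
  rw [Finset.sum_congr rfl fun j _ => hsplit j, Finset.sum_add_distrib, Finset.sum_ite_eq]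
  have hk := ha k k.2
  obtain ⟨i, hi⟩ := i
  cases i with
  | zero =>
    simp only [Fin.ext_iff]
    by_cases h : (k : ℕ) = 0
    · rw [h] at hk
      simp [h, hk]
    · simp [h, Ne.symm h]
  | succ i =>
    rw [Finset.sum_eq_single (⟨i, by omega⟩ : Fin l)]
    · simp only [Fin.ext_iff, Finset.mem_univ, if_true]
      rcases lt_trichotomy (k : ℕ) (i + 1) with h | h | h
      · rw [if_pos h.le, if_pos (by omega), if_neg (by omega)]; ring
      · rw [if_pos h.le, if_neg (by omega), if_pos h.symm, ← h]; simp [hk]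
      · rw [if_neg (by omega), if_neg (by omega), if_neg (by omega)]; ring
    · intro j _ hj
      rw [if_neg]
      exact fun e => hj (Fin.ext (Nat.succ_injective e).symm)
    · simp

/-- The sum of a lower triangular array with unit diagonal and off-diagonal entries at most `ρ`. -/
lemma sum_lowerTriangular_le {l : ℕ} (c : Fin l → Fin l → ℝ) {ρ : ℝ} (hρ : 0 ≤ ρ)
    (hdiag : ∀ i, c i i = 1) (hupper : ∀ i j, i < j → c i j = 0)
    (hlower : ∀ i j, j < i → c i j ≤ ρ) :
    ∑ i, ∑ j, c i j ≤ l * (1 + l * ρ / 2) := by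
  have key : ∑ i, ∑ j, (c i j + c j i) ≤
      ∑ i : Fin l, ∑ j : Fin l, ((if i = j then 2 else 0) + ρ) := by
    refine Finset.sum_le_sum fun i _ => Finset.sum_le_sum fun j _ => ?_
    rcases lt_trichotomy i j with h | h | h
    · rw [if_neg h.ne, hupper i j h]
      linarith [hlower j i h]
    · rw [if_pos h, h, hdiag]
      linarith
    · rw [if_neg h.ne', hupper j i h]
      linarith [hlower i j h]
  simp only [Finset.sum_add_distrib, Finset.sum_ite_eq, Finset.mem_univ, if_true,
    Finset.sum_const, Finset.card_univ, Fintype.card_fin, nsmul_eq_mul] at key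
  rw [Finset.sum_comm (f := fun i j => c j i)] at key
  linarith

lemma le_iSup_lowerTriangular {l : ℕ} (f : Fin l → Fin l → ℝ) {i j : Fin l}
    (hij : (j : ℕ) ≤ (i : ℕ)) :
    f i j ≤ ⨆ i : Fin l, ⨆ j : Fin l, ⨆ _ : (j : ℕ) ≤ (i : ℕ), f i j := by
  refine le_ciSup_of_le (Set.finite_range _).bddAbove i ?_
  refine le_ciSup_of_le (Set.finite_range _).bddAbove j ?_
  rw [ciSup_pos hij]

/-- **Spectral norm bound on `(T^(l))⁻¹`.** With `T^(l) = (1/α) L̃^(l) (L̃^(l))ᵀ`,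
`‖(T^(l))⁻¹‖₂ = α ‖(L̃^(l))⁻¹‖₂² ≤ α ‖(L̃^(l))⁻¹‖_F² ≤ α l (1 + lρ/2)`. -/
theorem T_inverse_spectral_bound
    (N l : ℕ) (hl : 1 ≤ l) (α : ℝ) (hα : 0 < α)
    (r : ℕ → Fin N → ℝ) (hrne : ∀ j < l, r j ≠ 0)
    (β : ℕ → ℝ)
    (hβ : ∀ j, 1 ≤ j → β j = (euclNorm (r j)) ^ 2 / (euclNorm (r (j - 1))) ^ 2)
    (Lt : Matrix (Fin l) (Fin l) ℝ)
    (hLt : Lt = Matrix.of fun (i j : Fin l) =>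
      if (i : ℕ) = (j : ℕ) then 1
      else if (i : ℕ) = (j : ℕ) + 1 then -Real.sqrt (β i) else 0)
    (ρ : ℝ)
    (hρ : ρ = ⨆ i : Fin l, ⨆ j : Fin l, ⨆ _ : (j : ℕ) ≤ (i : ℕ),
      (euclNorm (r i)) ^ 2 / (euclNorm (r j)) ^ 2)
    (T : Matrix (Fin l) (Fin l) ℝ) (hT : T = α⁻¹ • (Lt * Ltᵀ)) :
    specNorm T⁻¹ = α * (specNorm Lt⁻¹) ^ 2 ∧
    α * (specNorm Lt⁻¹) ^ 2 ≤ α * (∑ i, ∑ j, (Lt⁻¹ i j) ^ 2) ∧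
    α * (∑ i, ∑ j, (Lt⁻¹ i j) ^ 2) ≤ α * (l : ℝ) * (1 + (l : ℝ) * ρ / 2) := by
  set a : ℕ → ℝ := fun j => euclNorm (r j)
  have hapos : ∀ j < l, 0 < a j := fun j hj => euclNorm_pos (hrne j hj)
  have hLt' : Lt = Matrix.of fun i j : Fin l =>
      if (i : ℕ) = (j : ℕ) then 1
      else if (i : ℕ) = (j : ℕ) + 1 then -(a i / a (i - 1)) else 0 := by
    rw [hLt]
    ext i j
    simp only [Matrix.of_apply]
    split_ifs with h1 h2
    · rfl
    · rw [hβ i (by omega), ← div_pow,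
        Real.sqrt_sq (div_nonneg (euclNorm_nonneg _) (euclNorm_nonneg _))]
    · rfl
  have hright := lowerBidiagonal_mul_ratio (l := l) (a := a) fun j hj => (hapos j hj).ne'
  rw [← hLt'] at hright
  have hinv := Matrix.inv_eq_right_inv hright
  rw [← hinv] at hright
  have hTinv : T⁻¹ = α • ((Lt⁻¹)ᵀ * Lt⁻¹) := by
    refine Matrix.inv_eq_left_inv ?_
    rw [hT, Matrix.smul_mul, Matrix.mul_smul, smul_smul, mul_inv_cancel₀ hα.ne', one_smul,
      Matrix.mul_assoc, ← Matrix.mul_assoc Lt⁻¹, mul_eq_one_comm.1 hright, Matrix.one_mul,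
      ← Matrix.transpose_mul, hright, Matrix.transpose_one]
  refine ⟨?_, ?_, ?_⟩
  · rw [hTinv, specNorm_smul, specNorm_transpose_mul_self, abs_of_pos hα]
  · exact mul_le_mul_of_nonneg_left (specNorm_sq_le_sum_sq _) hα.le
  · rw [mul_assoc]
    refine mul_le_mul_of_nonneg_left ?_ hα.le
    have hle : ∀ i j : Fin l, (j : ℕ) ≤ (i : ℕ) → a i ^ 2 / a j ^ 2 ≤ ρ := fun i j hij =>
      hρ ▸ le_iSup_lowerTriangular (fun i j : Fin l => a i ^ 2 / a j ^ 2) hij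
    have hρ0 : 0 ≤ ρ := le_trans (by positivity) (hle ⟨0, hl⟩ ⟨0, hl⟩ le_rfl)
    rw [hinv]
    refine sum_lowerTriangular_le _ hρ0 (fun i => ?_) (fun i j hij => ?_) (fun i j hij => ?_)
    · simp [(hapos i i.2).ne']
    · simp [hij]
    · simpa [hij.le, div_pow] using hle i j hij.le
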